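/- arXiv:2302.02640 — 2 statements merged into one kernel-verified Lean document; each statement's English description precedes it below -/
import Mathlib

section
/- For every integer k ≥ 0 and every index α ∈ Λ_k, the Arar–Boulmezaoud function 𝒲_α satisfies the eigenvalue equation −Δ𝒲_α(x) = ((2k+1)(2k+3)/(|x|²+1)²) · 𝒲_α(x) for all x ∈ ℝ³. -/
open MeasureTheory Real Filter Metric
open scoped RealInnerProductSpace BigOperators

noncomputable section

abbrev E3 := EuclideanSpace ℝ (Fin 3)
abbrev E4 := EuclideanSpace ℝ (Fin 4)

/-- The index set `Λ = {(k,ℓ,m) : ℓ ≤ k, |m| ≤ ℓ}`. -/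
def memLam (α : ℕ × ℕ × ℤ) : Prop := α.2.1 ≤ α.1 ∧ α.2.2.natAbs ≤ α.2.1

/-- Associated Legendre function `P_ℓ^m(t) = ((-1)^m/(2^ℓ ℓ!)) (1-t²)^{m/2} (d/dt)^{ℓ+m}(t²-1)^ℓ`. -/
def legendreP (l m : ℕ) (t : ℝ) : ℝ :=
  ((-1:ℝ)^m / (2^l * (Nat.factorial l))) * (Real.sqrt (1 - t^2))^m *
    (Polynomial.derivative^[l+m] ((Polynomial.X^2 - 1 : Polynomial ℝ)^l)).eval t

/-- Normalized associated Legendre function `K_ℓ^m = (-1)^m √((ℓ-m)!/(ℓ+m)!) P_ℓ^m`. -/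
def Kfun (l m : ℕ) (t : ℝ) : ℝ :=
  (-1:ℝ)^m * Real.sqrt ((Nat.factorial (l-m)) / (Nat.factorial (l+m))) * legendreP l m t

/-- The angular factor `y_m`. -/
def ymfun (m : ℤ) (φ : ℝ) : ℝ :=
  if m = 0 then 1 / Real.sqrt 2
  else if 0 < m then Real.cos (m * φ)
  else Real.sin (|m| * φ)

/-- Real spherical harmonics `Y_{ℓ,m}` on `S²`. -/
def Y2fun (l : ℕ) (m : ℤ) (φ θ : ℝ) : ℝ :=
  Real.sqrt ((2*l+1)/(2*π)) * Kfun l m.natAbs (Real.cos θ) * ymfun m φ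

/-- Normalization constants `a_{k,ℓ} = ((k+1)π/2)·(k+ℓ+1)!/(k-ℓ)!`. -/
def akl (k l : ℕ) : ℝ :=
  ((k+1) * π / 2) * (Nat.factorial (k+l+1)) / (Nat.factorial (k-l))

/-- `d`-th derivative of the Chebyshev polynomial of the first kind `T_n`, evaluated at `t`. -/
def chebDeriv (n d : ℕ) (t : ℝ) : ℝ :=
  (Polynomial.derivative^[d] (Polynomial.Chebyshev.T ℝ (n : ℤ))).eval t

/-- Spherical harmonic `𝒴_α` on `S³`, as a function of the spherical coordinates `(φ,θ,χ)`:
`𝒴_α = a_{k,ℓ}^{-1/2} (sin χ)^ℓ T_{k+1}^{(ℓ+1)}(cos χ) Y_{ℓ,m}(φ,θ)`. -/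
def Yfun (α : ℕ × ℕ × ℤ) (φ θ χ : ℝ) : ℝ :=
  (1 / Real.sqrt (akl α.1 α.2.1)) * (Real.sin χ)^α.2.1 *
    chebDeriv (α.1+1) (α.2.1+1) (Real.cos χ) * Y2fun α.2.1 α.2.2 φ θ

/-- The azimuthal spherical coordinate `φ` of `π⁻¹(x)`. -/
def sphPhi (x : E3) : ℝ := Complex.arg ⟨x 0, x 1⟩

/-- The polar spherical coordinate `θ` of `π⁻¹(x)`, i.e. `cos θ = x₃/|x|`. -/
def sphTheta (x : E3) : ℝ := Real.arccos (x 2 / ‖x‖)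

/-- The spherical coordinate `χ` of `π⁻¹(x)`, i.e. `cos χ = (|x|²-1)/(|x|²+1)`. -/
def sphChi (x : E3) : ℝ := Real.arccos ((‖x‖^2 - 1) / (‖x‖^2 + 1))

/-- The Arar–Boulmezaoud function `𝒲_α(x) = (2/(|x|²+1))^{1/2} 𝒴_α(π⁻¹(x))`. -/
def Wfun (α : ℕ × ℕ × ℤ) (x : E3) : ℝ :=
  Real.sqrt (2 / (‖x‖^2 + 1)) * Yfun α (sphPhi x) (sphTheta x) (sphChi x)

/-- Partial derivative in the `i`-th coordinate direction. -/
def pd3 (i : Fin 3) (f : E3 → ℝ) (x : E3) : ℝ := fderiv ℝ f x (EuclideanSpace.single i 1)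

/-- The Laplacian on `ℝ³`. -/
def laplacian (f : E3 → ℝ) (x : E3) : ℝ := ∑ i : Fin 3, pd3 i (fun y => pd3 i f y) x

/-! ### Partial derivatives -/

lemma pd3_mul (i : Fin 3) {f g : E3 → ℝ} {x : E3} (hf : DifferentiableAt ℝ f x)
    (hg : DifferentiableAt ℝ g x) :
    pd3 i (fun y => f y * g y) x = pd3 i f x * g x + f x * pd3 i g x := by
  simp only [pd3]
  rw [fderiv_fun_mul hf hg]
  simp
  ring

lemma pd3_add (i : Fin 3) {f g : E3 → ℝ} {x : E3} (hf : DifferentiableAt ℝ f x)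
    (hg : DifferentiableAt ℝ g x) :
    pd3 i (fun y => f y + g y) x = pd3 i f x + pd3 i g x := by
  simp only [pd3]
  rw [fderiv_fun_add hf hg]
  simp

lemma pd3_sum {ι : Type*} (i : Fin 3) (s : Finset ι) {f : ι → E3 → ℝ} {x : E3}
    (hf : ∀ j ∈ s, DifferentiableAt ℝ (f j) x) :
    pd3 i (fun y => ∑ j ∈ s, f j y) x = ∑ j ∈ s, pd3 i (f j) x := by
  simp only [pd3]
  rw [fderiv_fun_sum hf]
  simp

lemma pd3_const_mul (i : Fin 3) (c : ℝ) {f : E3 → ℝ} {x : E3} (hf : DifferentiableAt ℝ f x) :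
    pd3 i (fun y => c * f y) x = c * pd3 i f x := by
  simp only [pd3]
  rw [fderiv_const_mul hf]
  simp

lemma pd3_const_mul_coord (i : Fin 3) (c : ℝ) (x : E3) : pd3 i (fun y => c * y i) x = c := by
  have h : HasFDerivAt (fun y : E3 => c * y i) (c • (EuclideanSpace.proj i : E3 →L[ℝ] ℝ)) x :=
    (EuclideanSpace.proj i : E3 →L[ℝ] ℝ).hasFDerivAt.const_mul c
  simp [pd3, h.fderiv]

lemma hasFDerivAt_comp_norm_sq {F : ℝ → ℝ} {F' : ℝ} {x : E3} (hF : HasDerivAt F F' (‖x‖ ^ 2)) :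
    HasFDerivAt (fun y : E3 => F (‖y‖ ^ 2)) (F' • (2 • innerSL ℝ x)) x :=
  hF.comp_hasFDerivAt x (hasStrictFDerivAt_norm_sq x).hasFDerivAt

lemma pd3_comp_norm_sq (i : Fin 3) {F : ℝ → ℝ} {F' : ℝ} {x : E3}
    (hF : HasDerivAt F F' (‖x‖ ^ 2)) : pd3 i (fun y => F (‖y‖ ^ 2)) x = 2 * x i * F' := by
  rw [pd3, (hasFDerivAt_comp_norm_sq hF).fderiv]
  simp [EuclideanSpace.inner_single_right]
  ring

lemma ContDiff.differentiable_pd3 {f : E3 → ℝ} (hf : ContDiff ℝ 2 f) (i : Fin 3) :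
    Differentiable ℝ (pd3 i f) :=
  ((hf.fderiv_right (m := 1) (by norm_num)).clm_apply contDiff_const).differentiable one_ne_zero

lemma laplacian_sum {ι : Type*} (s : Finset ι) {f : ι → E3 → ℝ} (hf : ∀ j, ContDiff ℝ 2 (f j))
    (x : E3) : laplacian (fun y => ∑ j ∈ s, f j y) x = ∑ j ∈ s, laplacian (f j) x := by
  have hd (j : ι) : Differentiable ℝ (f j) := (hf j).differentiable two_ne_zero
  have h (i : Fin 3) : (fun y => pd3 i (fun y => ∑ j ∈ s, f j y) y)
      = fun y => ∑ j ∈ s, pd3 i (f j) y :=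
    funext fun y => pd3_sum i s fun j _ => hd j y
  simp only [laplacian, h]
  rw [Finset.sum_comm]
  exact Finset.sum_congr rfl fun i _ => pd3_sum i s fun j _ => (hf j).differentiable_pd3 i x

lemma laplacian_const_mul (c : ℝ) {f : E3 → ℝ} (hf : ContDiff ℝ 2 f) (x : E3) :
    laplacian (fun y => c * f y) x = c * laplacian f x := by
  have h (i : Fin 3) : (fun y => pd3 i (fun y => c * f y) y) = fun y => c * pd3 i f y :=
    funext fun y => pd3_const_mul i c (hf.differentiable two_ne_zero y)
  simp only [laplacian, h, Finset.mul_sum]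
  exact Finset.sum_congr rfl fun i _ => pd3_const_mul i c (hf.differentiable_pd3 i x)

/-- The Laplacian of a radial function times a homogeneous function of degree `n`. -/
lemma laplacian_radial_mul {F F₁ F₂ : ℝ → ℝ} (hF : ∀ s, 0 ≤ s → HasDerivAt F (F₁ s) s)
    (hF₁ : ∀ s, 0 ≤ s → HasDerivAt F₁ (F₂ s) s) {H : E3 → ℝ} (hH : ContDiff ℝ 2 H) {n : ℝ}
    (euler : ∀ x : E3, ∑ i, x i * pd3 i H x = n * H x) (x : E3) :
    laplacian (fun y => F (‖y‖ ^ 2) * H y) x = F (‖x‖ ^ 2) * laplacian H x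
      + (4 * ‖x‖ ^ 2 * F₂ (‖x‖ ^ 2) + (6 + 4 * n) * F₁ (‖x‖ ^ 2)) * H x := by
  have hFd (y : E3) := hF (‖y‖ ^ 2) (sq_nonneg _)
  have hF₁d (y : E3) := hF₁ (‖y‖ ^ 2) (sq_nonneg _)
  have dF : Differentiable ℝ fun y : E3 => F (‖y‖ ^ 2) :=
    fun y => (hasFDerivAt_comp_norm_sq (hFd y)).differentiableAt
  have dF₁ : Differentiable ℝ fun y : E3 => F₁ (‖y‖ ^ 2) :=
    fun y => (hasFDerivAt_comp_norm_sq (hF₁d y)).differentiableAt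
  have dH : Differentiable ℝ H := hH.differentiable two_ne_zero
  have dx (i : Fin 3) : Differentiable ℝ fun y : E3 => 2 * y i := by fun_prop
  have first (i : Fin 3) : (fun y => pd3 i (fun y => F (‖y‖ ^ 2) * H y) y)
      = fun y => 2 * y i * F₁ (‖y‖ ^ 2) * H y + F (‖y‖ ^ 2) * pd3 i H y := by
    funext y
    rw [pd3_mul i (dF y) (dH y), pd3_comp_norm_sq i (hFd y)]
  have second (i : Fin 3) : pd3 i (fun y => pd3 i (fun y => F (‖y‖ ^ 2) * H y) y) x
      = F (‖x‖ ^ 2) * pd3 i (fun y => pd3 i H y) x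
        + (2 * F₁ (‖x‖ ^ 2) + 4 * x i ^ 2 * F₂ (‖x‖ ^ 2)) * H x
        + 4 * F₁ (‖x‖ ^ 2) * (x i * pd3 i H x) := by
    have dp := hH.differentiable_pd3 i
    rw [first, pd3_add i ((((dx i).fun_mul dF₁).fun_mul dH) x) ((dF.fun_mul dp) x),
      pd3_mul i (((dx i).fun_mul dF₁) x) (dH x), pd3_mul i (dx i x) (dF₁ x), pd3_mul i (dF x) (dp x),
      pd3_const_mul_coord, pd3_comp_norm_sq i (hFd x), pd3_comp_norm_sq i (hF₁d x)]
    ring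
  have hn := EuclideanSpace.real_norm_sq_eq x
  have he := euler x
  simp only [laplacian, second]
  simp only [Fin.sum_univ_three] at hn he ⊢
  linear_combination 4 * F₁ (‖x‖ ^ 2) * he - 4 * F₂ (‖x‖ ^ 2) * H x * hn

/-! ### Solid harmonics -/

/-- The linear map `x ↦ x₁ + i x₂`. -/
def planeProj : E3 →L[ℝ] ℂ :=
  Complex.ofRealCLM.comp (EuclideanSpace.proj 0)
    + Complex.I • Complex.ofRealCLM.comp (EuclideanSpace.proj 1)

lemma planeProj_apply (x : E3) : planeProj x = ⟨x 0, x 1⟩ := by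
  apply Complex.ext <;> simp [planeProj]

/-- The polynomial `Re (c (x₁ + i x₂)^m) x₃^j`. -/
def cylMonomial (c : ℂ) (m j : ℕ) (x : E3) : ℝ := (c * planeProj x ^ m).re * x 2 ^ j

lemma contDiff_cylMonomial (c : ℂ) (m j : ℕ) : ContDiff ℝ 2 (cylMonomial c m j) := by
  have h : ContDiff ℝ 2 fun x : E3 => Complex.reCLM (c * planeProj x ^ m) * x 2 ^ j := by
    fun_prop
  exact h

lemma hasFDerivAt_re_planeProj_pow (c : ℂ) (m : ℕ) (x : E3) :
    HasFDerivAt (fun y => (c * planeProj y ^ m).re)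
      (Complex.reCLM.comp (c • (m * planeProj x ^ (m - 1)) • planeProj)) x := by
  have h := (planeProj.hasFDerivAt (x := x)).pow m
  rw [nsmul_eq_mul] at h
  exact Complex.reCLM.hasFDerivAt.comp x (h.const_mul c)

lemma pd3_cylMonomial (i : Fin 3) (c : ℂ) (m j : ℕ) (x : E3) :
    pd3 i (cylMonomial c m j) x =
      (c * (m * planeProj x ^ (m - 1)) * planeProj (EuclideanSpace.single i 1)).re * x 2 ^ j
      + (c * planeProj x ^ m).re * (j * x 2 ^ (j - 1) * if i = 2 then 1 else 0) := by
  have h2 : HasFDerivAt (fun y : E3 => y 2 ^ j)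
      ((j * x 2 ^ (j - 1)) • (EuclideanSpace.proj 2 : E3 →L[ℝ] ℝ)) x := by
    have := ((EuclideanSpace.proj 2 : E3 →L[ℝ] ℝ).hasFDerivAt (x := x)).pow j
    rw [nsmul_eq_mul] at this
    exact this
  have h1 := hasFDerivAt_re_planeProj_pow c m x
  have e : cylMonomial c m j = fun y => (c * planeProj y ^ m).re * y 2 ^ j := rfl
  rw [e, pd3_mul i h1.differentiableAt h2.differentiableAt]
  simp only [pd3, h1.fderiv, h2.fderiv]
  congr 1
  · simp [mul_assoc]
  · simp [eq_comm]

lemma pd3_zero_cylMonomial (c : ℂ) (m j : ℕ) :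
    (fun x => pd3 0 (cylMonomial c m j) x) = cylMonomial (c * m) (m - 1) j := by
  funext x
  rw [pd3_cylMonomial]
  have : planeProj (EuclideanSpace.single 0 1) = 1 := by simp [planeProj]
  rw [this, cylMonomial]
  simp only [Fin.reduceEq, if_false, mul_zero, add_zero]
  ring_nf

lemma pd3_one_cylMonomial (c : ℂ) (m j : ℕ) :
    (fun x => pd3 1 (cylMonomial c m j) x) = cylMonomial (c * m * Complex.I) (m - 1) j := by
  funext x
  rw [pd3_cylMonomial]
  have : planeProj (EuclideanSpace.single 1 1) = Complex.I := by simp [planeProj]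
  rw [this, cylMonomial]
  simp only [Fin.reduceEq, if_false, mul_zero, add_zero]
  ring_nf

lemma pd3_two_cylMonomial (c : ℂ) (m j : ℕ) :
    (fun x => pd3 2 (cylMonomial c m j) x) = cylMonomial (c * j) m (j - 1) := by
  funext x
  rw [pd3_cylMonomial]
  have : planeProj (EuclideanSpace.single 2 1) = 0 := by simp [planeProj]
  have h : c * (j : ℂ) * planeProj x ^ m = ((j : ℝ) : ℂ) * (c * planeProj x ^ m) := by
    push_cast; ring
  rw [this, cylMonomial, h, Complex.re_ofReal_mul]
  simp only [if_true, mul_zero, Complex.zero_re]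
  ring

lemma laplacian_cylMonomial (c : ℂ) (m j : ℕ) (x : E3) :
    laplacian (cylMonomial c m j) x = j * (j - 1) * cylMonomial c m (j - 2) x := by
  have h0 := congrFun (pd3_zero_cylMonomial (c * m) (m - 1) j) x
  have h1 := congrFun (pd3_one_cylMonomial (c * m * Complex.I) (m - 1) j) x
  have h2 := congrFun (pd3_two_cylMonomial (c * j) m (j - 1)) x
  rw [laplacian, Fin.sum_univ_three, pd3_zero_cylMonomial, pd3_one_cylMonomial,
    pd3_two_cylMonomial, h0, h1, h2]
  have e1 : c * m * Complex.I * ((m - 1 : ℕ) : ℂ) * Complex.I = -(c * m * ((m - 1 : ℕ) : ℂ)) := by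
    linear_combination c * m * ((m - 1 : ℕ) : ℂ) * Complex.I_sq
  have e2 : c * (j : ℂ) * ((j - 1 : ℕ) : ℂ) = ((j * (j - 1) : ℝ) : ℂ) * c := by
    rcases j with _ | j
    · simp
    · push_cast; simp; ring
  rw [e1, e2]
  simp only [cylMonomial, neg_mul, Complex.neg_re, Nat.sub_sub, Nat.reduceAdd]
  rw [mul_assoc _ c, Complex.re_ofReal_mul]
  ring

lemma euler_cylMonomial (c : ℂ) (m j : ℕ) (x : E3) :
    ∑ i, x i * pd3 i (cylMonomial c m j) x = (m + j) * cylMonomial c m j x := by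
  have h0 := congrFun (pd3_zero_cylMonomial c m j) x
  have h1 := congrFun (pd3_one_cylMonomial c m j) x
  have h2 := congrFun (pd3_two_cylMonomial c m j) x
  rw [Fin.sum_univ_three, h0, h1, h2]
  have e1 : x 0 * (c * m * planeProj x ^ (m - 1)).re
      + x 1 * (c * m * Complex.I * planeProj x ^ (m - 1)).re = m * (c * planeProj x ^ m).re := by
    simp only [← Complex.re_ofReal_mul, ← Complex.add_re]
    have hw : planeProj x = x 0 + x 1 * Complex.I := by
      apply Complex.ext <;> simp [planeProj]
    congr 1
    rcases m with _ | m
    · simp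
    · rw [pow_succ, Nat.add_sub_cancel]
      push_cast
      linear_combination -c * (m + 1) * planeProj x ^ m * hw
  have e2 : x 2 * ((c * j * planeProj x ^ m).re * x 2 ^ (j - 1))
      = j * ((c * planeProj x ^ m).re * x 2 ^ j) := by
    have : c * j * planeProj x ^ m = ((j : ℝ) : ℂ) * (c * planeProj x ^ m) := by
      push_cast; ring
    rw [this, Complex.re_ofReal_mul]
    rcases j with _ | j
    · simp
    · rw [pow_succ, Nat.add_sub_cancel]
      ring
  simp only [cylMonomial]
  linear_combination x 2 ^ j * e1 + e2

lemma euler_radial_mul {F : ℝ → ℝ} {F' n : ℝ} {H : E3 → ℝ} {x : E3}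
    (hF : HasDerivAt F F' (‖x‖ ^ 2)) (hH : DifferentiableAt ℝ H x)
    (euler : ∑ i, x i * pd3 i H x = n * H x) :
    ∑ i, x i * pd3 i (fun y => F (‖y‖ ^ 2) * H y) x
      = (2 * ‖x‖ ^ 2 * F' + n * F (‖x‖ ^ 2)) * H x := by
  have h (i : Fin 3) : pd3 i (fun y => F (‖y‖ ^ 2) * H y) x
      = 2 * x i * F' * H x + F (‖x‖ ^ 2) * pd3 i H x := by
    rw [pd3_mul i (hasFDerivAt_comp_norm_sq hF).differentiableAt hH, pd3_comp_norm_sq i hF]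
  have hn := EuclideanSpace.real_norm_sq_eq x
  simp only [h]
  simp only [Fin.sum_univ_three] at hn euler ⊢
  linear_combination F (‖x‖ ^ 2) * euler - 2 * F' * H x * hn

/-- The polynomial `|x|^(2p) Re (c (x₁ + i x₂)^m) x₃^j`. -/
def solidMonomial (c : ℂ) (m p j : ℕ) (x : E3) : ℝ := (‖x‖ ^ 2) ^ p * cylMonomial c m j x

lemma contDiff_solidMonomial (c : ℂ) (m p j : ℕ) : ContDiff ℝ 2 (solidMonomial c m p j) :=
  ((contDiff_norm_sq ℝ).pow p).mul (contDiff_cylMonomial c m j)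

lemma euler_solidMonomial (c : ℂ) (m p j : ℕ) (x : E3) :
    ∑ i, x i * pd3 i (solidMonomial c m p j) x = (2 * p + m + j) * solidMonomial c m p j x := by
  have h := euler_radial_mul (x := x) (hasDerivAt_pow p (‖x‖ ^ 2))
    ((contDiff_cylMonomial c m j).differentiable two_ne_zero x) (euler_cylMonomial c m j x)
  refine h.trans ?_
  rcases p with _ | p
  · simp [solidMonomial]
  · simp only [solidMonomial, Nat.add_sub_cancel]
    ring

lemma laplacian_solidMonomial (c : ℂ) (m p j : ℕ) (x : E3) :
    laplacian (solidMonomial c m p j) x = j * (j - 1) * solidMonomial c m p (j - 2) x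
      + 2 * p * (2 * p + 1 + 2 * m + 2 * j) * solidMonomial c m (p - 1) j x := by
  have h := laplacian_radial_mul (fun s _ => hasDerivAt_pow p s)
    (fun s _ => (hasDerivAt_pow (p - 1) s).const_mul (p : ℝ))
    (contDiff_cylMonomial c m j) (euler_cylMonomial c m j) x
  refine h.trans ?_
  rw [laplacian_cylMonomial]
  rcases p with _ | _ | p
  · simp [solidMonomial]
  · simp [solidMonomial]
    ring
  · simp only [solidMonomial, Nat.succ_sub_succ, Nat.sub_zero]
    push_cast
    ring

/-- The coefficient of `t^(l-m-2p)` in the `(l+m)`-th derivative of `(t²-1)^l`. -/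
def legendreCoeff (l m p : ℕ) : ℝ :=
  (-1) ^ p * l.choose p * (2 * (l - p)).descFactorial (l + m)

lemma eval_iterate_derivative_X_sq_sub_one_pow (l m : ℕ) (t : ℝ) :
    (Polynomial.derivative^[l + m] ((Polynomial.X ^ 2 - 1 : Polynomial ℝ) ^ l)).eval t
      = ∑ p ∈ Finset.range (l + 1), legendreCoeff l m p * t ^ (l - m - 2 * p) := by
  have h : (Polynomial.X ^ 2 - 1 : Polynomial ℝ) ^ l = ∑ p ∈ Finset.range (l + 1),
      Polynomial.C ((-1 : ℝ) ^ p * l.choose p) * Polynomial.X ^ (2 * (l - p)) := by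
    rw [sub_eq_neg_add, add_pow]
    refine Finset.sum_congr rfl fun p _ => ?_
    simp [pow_mul]
    ring
  rw [h, Polynomial.iterate_derivative_sum, Polynomial.eval_finsetSum]
  refine Finset.sum_congr rfl fun p hp => ?_
  have hp' := Finset.mem_range.mp hp
  rw [Polynomial.iterate_derivative_C_mul, Polynomial.iterate_derivative_X_pow_eq_C_mul,
    show 2 * (l - p) - (l + m) = l - m - 2 * p by omega]
  simp [legendreCoeff, mul_assoc]

lemma legendreCoeff_eq_zero {l m p : ℕ} (hp : p ≤ l) (h : l < m + 2 * p) :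
    legendreCoeff l m p = 0 := by
  have : (2 * (l - p)).descFactorial (l + m) = 0 :=
    Nat.descFactorial_eq_zero_iff_lt.mpr (by omega)
  simp [legendreCoeff, this]

lemma legendreCoeff_succ {l m p : ℕ} (hp : p < l) :
    legendreCoeff l m (p + 1) * (2 * ((p + 1 : ℕ) : ℝ)
        * (2 * ((p + 1 : ℕ) : ℝ) + 1 + 2 * m + 2 * ((l - m - 2 * (p + 1) : ℕ) : ℝ)))
      = -(legendreCoeff l m p
        * (((l - m - 2 * p : ℕ) : ℝ) * (((l - m - 2 * p : ℕ) : ℝ) - 1))) := by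
  rcases lt_or_ge l (m + 2 * (p + 1)) with h | h
  · rw [legendreCoeff_eq_zero hp h]
    have : l - m - 2 * p = 0 ∨ l - m - 2 * p = 1 := by omega
    rcases this with h | h <;> simp [h]
  · obtain ⟨e, rfl⟩ := Nat.exists_eq_add_of_le h
    have e1 : m + 2 * (p + 1) + e - m - 2 * (p + 1) = e := by omega
    have e2 : m + 2 * (p + 1) + e - m - 2 * p = e + 2 := by omega
    have e3 : 2 * (m + 2 * (p + 1) + e - (p + 1)) = 2 * m + 2 * p + 2 * e + 2 := by omega
    have e4 : 2 * (m + 2 * (p + 1) + e - p) = 2 * m + 2 * p + 2 * e + 2 + 1 + 1 := by omega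
    have hc := Nat.choose_succ_right_eq (m + 2 * (p + 1) + e) p
    rw [show m + 2 * (p + 1) + e - p = m + p + e + 2 by omega] at hc
    have hd₁ := Nat.succ_descFactorial (2 * m + 2 * p + 2 * e + 2) (m + 2 * (p + 1) + e + m)
    have hd₂ := Nat.succ_descFactorial (2 * m + 2 * p + 2 * e + 2 + 1) (m + 2 * (p + 1) + e + m)
    rw [show 2 * m + 2 * p + 2 * e + 2 + 1 - (m + 2 * (p + 1) + e + m) = e + 1 by omega] at hd₁
    rw [show 2 * m + 2 * p + 2 * e + 2 + 1 + 1 - (m + 2 * (p + 1) + e + m) = e + 2 by omega] at hd₂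
    simp only [legendreCoeff, e1, e2, e3, e4]
    generalize (m + 2 * (p + 1) + e).choose (p + 1) = C₁ at *
    generalize (m + 2 * (p + 1) + e).choose p = C₀ at *
    generalize (2 * m + 2 * p + 2 * e + 2 + 1 + 1).descFactorial _ = D₂ at *
    generalize (2 * m + 2 * p + 2 * e + 2 + 1).descFactorial _ = D₁ at *
    generalize (2 * m + 2 * p + 2 * e + 2).descFactorial _ = D₀ at *
    replace hc := congrArg (Nat.cast (R := ℝ)) hc
    replace hd₁ := congrArg (Nat.cast (R := ℝ)) hd₁
    replace hd₂ := congrArg (Nat.cast (R := ℝ)) hd₂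
    push_cast at hc hd₁ hd₂ ⊢
    linear_combination -(-1) ^ p * (2 * D₀ * (2 * p + 3 + 2 * m + 2 * e) * hc
      - 2 * C₀ * (m + p + e + 2) * hd₁ - C₀ * (e + 1) * hd₂)

/-- The solid harmonic of degree `l` and order `m`. -/
def solidHarmonic (c : ℂ) (l m : ℕ) (x : E3) : ℝ :=
  ∑ p ∈ Finset.range (l + 1), legendreCoeff l m p * solidMonomial c m p (l - m - 2 * p) x

lemma contDiff_solidHarmonic (c : ℂ) (l m : ℕ) : ContDiff ℝ 2 (solidHarmonic c l m) :=
  ContDiff.sum fun _ _ => contDiff_const.mul (contDiff_solidMonomial _ _ _ _)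

lemma euler_solidHarmonic (c : ℂ) (l m : ℕ) (x : E3) :
    ∑ i, x i * pd3 i (solidHarmonic c l m) x = l * solidHarmonic c l m x := by
  have hd (p : ℕ) : DifferentiableAt ℝ (solidMonomial c m p (l - m - 2 * p)) x :=
    (contDiff_solidMonomial _ _ _ _).differentiable two_ne_zero x
  have h (i : Fin 3) : pd3 i (solidHarmonic c l m) x = ∑ p ∈ Finset.range (l + 1),
      legendreCoeff l m p * pd3 i (solidMonomial c m p (l - m - 2 * p)) x :=
    (pd3_sum i _ fun p _ => (hd p).const_mul _).trans
      (Finset.sum_congr rfl fun p _ => pd3_const_mul i _ (hd p))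
  simp only [h, Finset.mul_sum, solidHarmonic]
  rw [Finset.sum_comm]
  refine Finset.sum_congr rfl fun p hp => ?_
  have he := euler_solidMonomial c m p (l - m - 2 * p) x
  have hp' := Finset.mem_range_succ_iff.mp hp
  simp only [mul_left_comm _ (legendreCoeff l m p), ← Finset.mul_sum]
  rcases lt_or_ge l (m + 2 * p) with hlt | hge
  · simp [legendreCoeff_eq_zero hp' hlt]
  · rw [he]
    have : (2 * p + m + (l - m - 2 * p : ℕ) : ℝ) = l := by
      have : 2 * p + m + (l - m - 2 * p) = l := by omega
      exact_mod_cast this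
    rw [this]

lemma sum_range_succ_telescope {A B : ℕ → ℝ} (h0 : B 0 = 0) (n : ℕ)
    (h : ∀ p < n, B (p + 1) = -A p) : ∑ p ∈ Finset.range (n + 1), (A p + B p) = A n := by
  induction n with
  | zero => simp [h0]
  | succ n ih =>
    rw [Finset.sum_range_succ, ih fun p hp => h p (hp.trans n.lt_succ_self), h n n.lt_succ_self]
    ring

lemma laplacian_solidHarmonic (c : ℂ) (l m : ℕ) (x : E3) :
    laplacian (solidHarmonic c l m) x = 0 := by
  have h : laplacian (solidHarmonic c l m) x = ∑ p ∈ Finset.range (l + 1),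
      legendreCoeff l m p * laplacian (solidMonomial c m p (l - m - 2 * p)) x :=
    (laplacian_sum _ (fun p => contDiff_const.mul (contDiff_solidMonomial _ _ _ _)) x).trans
      (Finset.sum_congr rfl fun p _ => laplacian_const_mul _ (contDiff_solidMonomial _ _ _ _) x)
  simp only [h, laplacian_solidMonomial, mul_add (legendreCoeff l m _)]
  rw [sum_range_succ_telescope]
  · have : l - m - 2 * l = 0 := by omega
    simp [this]
  · simp
  · intro p hp
    have e : l - m - 2 * (p + 1) = l - m - 2 * p - 2 := by omega
    have hs := legendreCoeff_succ (m := m) hp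
    rw [Nat.add_sub_cancel, ← mul_assoc, hs, ← e]
    ring

/-! ### The radial profile -/

/-- The function `s ↦ (2/(s+1))^{1/2} (s+1)^{-n} R((s-1)/(s+1))`. -/
def radialProfile (n : ℕ) (R : Polynomial ℝ) (s : ℝ) : ℝ :=
  √(2 / (s + 1)) * (1 / (s + 1)) ^ n * R.eval ((s - 1) / (s + 1))

lemma hasDerivAt_radialProfile (n : ℕ) (R : Polynomial ℝ) {s : ℝ} (hs : 0 ≤ s) :
    HasDerivAt (radialProfile n R) (-(n + 1 / 2) * radialProfile (n + 1) R s
      + 2 * radialProfile (n + 2) R.derivative s) s := by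
  have h1 : s + 1 ≠ 0 := by positivity
  have hi : HasDerivAt (fun s : ℝ => s + 1) 1 s := (hasDerivAt_id s).add_const 1
  have hv : HasDerivAt (fun s : ℝ => 1 / (s + 1)) (-(1 / (s + 1)) ^ 2) s := by
    refine ((hasDerivAt_const s (1 : ℝ)).fun_div hi h1).congr_deriv ?_
    field_simp
    ring
  have hw : HasDerivAt (fun s : ℝ => 2 / (s + 1)) (-2 * (1 / (s + 1)) ^ 2) s := by
    refine ((hasDerivAt_const s (2 : ℝ)).fun_div hi h1).congr_deriv ?_
    field_simp
    ring
  have hu : HasDerivAt (fun s : ℝ => (s - 1) / (s + 1)) (2 * (1 / (s + 1)) ^ 2) s := by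
    refine (((hasDerivAt_id' s).sub_const 1).fun_div hi h1).congr_deriv ?_
    field_simp
    ring
  have hpos : 0 < 2 / (s + 1) := by positivity
  have hsq : √(2 / (s + 1)) ^ 2 = 2 * (1 / (s + 1)) := by
    rw [Real.sq_sqrt hpos.le]
    ring
  have hE := ((hw.sqrt hpos.ne').fun_mul (hv.fun_pow n)).fun_mul ((R.hasDerivAt _).comp s hu)
  refine hE.congr_deriv ?_
  have hd : -2 * (1 / (s + 1)) ^ 2 / (2 * √(2 / (s + 1)))
      = -(1 / 2) * (1 / (s + 1)) * √(2 / (s + 1)) := by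
    rw [div_eq_iff (by positivity)]
    linear_combination (1 / (s + 1)) * hsq
  rw [hd]
  simp only [radialProfile, Function.comp_apply]
  generalize 1 / (s + 1) = v
  rcases n with _ | n
  · simp
    ring
  · simp only [Nat.add_sub_cancel]
    push_cast
    ring

lemma radialProfile_chebyshev_ode (k l : ℕ) {s : ℝ} (hs : 0 ≤ s) :
    let Q := Polynomial.derivative^[l + 1] (Polynomial.Chebyshev.T ℝ ((k + 1 : ℕ) : ℤ))
    4 * s * (-(l + 1 / 2) * (-((l + 1 : ℕ) + 1 / 2) * radialProfile (l + 1 + 1) Q s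
          + 2 * radialProfile (l + 1 + 2) Q.derivative s)
        + 2 * (-((l + 2 : ℕ) + 1 / 2) * radialProfile (l + 2 + 1) Q.derivative s
          + 2 * radialProfile (l + 2 + 2) Q.derivative.derivative s))
      + (6 + 4 * l) * (-(l + 1 / 2) * radialProfile (l + 1) Q s
          + 2 * radialProfile (l + 2) Q.derivative s)
      = -((2 * k + 1) * (2 * k + 3) / (s + 1) ^ 2 * radialProfile l Q s) := by
  intro Q
  have h1 : s + 1 ≠ 0 := by positivity
  have ode := Polynomial.Chebyshev.one_sub_X_sq_mul_iterate_derivative_T_eval (R := ℝ)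
    ((k + 1 : ℕ) : ℤ) (l + 1) ((s - 1) / (s + 1))
  have hQ₁ : Polynomial.derivative^[l + 1 + 1] (Polynomial.Chebyshev.T ℝ ((k + 1 : ℕ) : ℤ))
      = Q.derivative := Function.iterate_succ_apply' _ _ _
  have hQ₂ : Polynomial.derivative^[l + 1 + 2] (Polynomial.Chebyshev.T ℝ ((k + 1 : ℕ) : ℤ))
      = Q.derivative.derivative := by
    rw [← hQ₁, ← Function.iterate_succ_apply' Polynomial.derivative]
  rw [hQ₁, hQ₂, show Polynomial.derivative^[l + 1] _ = Q from rfl] at ode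
  simp only [radialProfile]
  have hu : (s - 1) / (s + 1) = 1 - 2 * (1 / (s + 1)) := by field_simp; ring
  have hs' : s * (1 / (s + 1)) = 1 - 1 / (s + 1) := by field_simp; ring
  have hsq : (2 * (k : ℝ) + 1) * (2 * k + 3) / (s + 1) ^ 2
      = (2 * k + 1) * (2 * k + 3) * (1 / (s + 1)) ^ 2 := by field_simp
  rw [hsq]
  rw [hu] at ode ⊢
  generalize 1 / (s + 1) = v at *
  generalize Q.eval _ = q₀ at *
  generalize Q.derivative.eval _ = q₁ at *
  generalize Q.derivative.derivative.eval _ = q₂ at *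
  generalize √(2 / (s + 1)) = E at *
  push_cast at ode ⊢
  linear_combination 4 * E * v ^ (l + 2) * ode + E * v ^ l * (16 * v ^ 3 * q₂
    - (4 * (2 * l + 1) + 4 * (2 * l + 5)) * v ^ 2 * q₁ + (2 * l + 1) * (2 * l + 3) * v * q₀) * hs'

/-! ### Factorization of the Arar–Boulmezaoud functions -/

/-- The complex constant `c` with `Re (c e^{i|m|φ}) = y_m(φ)`. -/
def azimuthConst (m : ℤ) : ℂ :=
  if m = 0 then ((1 / √2 : ℝ) : ℂ) else if 0 < m then 1 else -Complex.I

lemma norm_pow_mul_ymfun (m : ℤ) (w : ℂ) :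
    ‖w‖ ^ m.natAbs * ymfun m w.arg = (azimuthConst m * w ^ m.natAbs).re := by
  have hw : w ^ m.natAbs = ((‖w‖ ^ m.natAbs : ℝ) : ℂ)
      * (Complex.cos ((m.natAbs * w.arg : ℝ) : ℂ)
        + Complex.sin ((m.natAbs * w.arg : ℝ) : ℂ) * Complex.I) := by
    conv_lhs => rw [← Complex.norm_mul_cos_add_sin_mul_I w, mul_pow,
      Complex.cos_add_sin_mul_I_pow]
    push_cast
    rfl
  rcases lt_trichotomy m 0 with h | h | h
  · have hc : (m.natAbs : ℝ) = (|m| : ℤ) := Nat.cast_natAbs m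
    rw [hw, ymfun, azimuthConst, if_neg h.ne, if_neg h.not_gt, if_neg h.ne, if_neg h.not_gt,
      ← Complex.ofReal_cos, ← Complex.ofReal_sin, hc]
    generalize ‖w‖ ^ m.natAbs = ρ
    generalize Real.cos _ = a
    generalize Real.sin _ = b
    simp
  · subst h
    simp only [ymfun, azimuthConst, if_true, Int.natAbs_zero, pow_zero, one_mul, mul_one,
      Complex.ofReal_re]
  · have hc : (m.natAbs : ℝ) = m := by
      rw [Nat.cast_natAbs, abs_of_pos h]
    rw [hw, ymfun, azimuthConst, if_neg h.ne', if_pos h, if_neg h.ne', if_pos h,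
      ← Complex.ofReal_cos, ← Complex.ofReal_sin, hc]
    generalize ‖w‖ ^ m.natAbs = ρ
    generalize Real.cos _ = a
    generalize Real.sin _ = b
    simp

lemma abs_coord_le_norm (x : E3) (i : Fin 3) : |x i| ≤ ‖x‖ := by
  simpa using PiLp.norm_apply_le x i

lemma norm_mul_cos_sphTheta (x : E3) : ‖x‖ * Real.cos (sphTheta x) = x 2 := by
  have h := abs_coord_le_norm x 2
  rcases (norm_nonneg x).eq_or_lt' with h0 | h0
  · have : x 2 = 0 := by simpa [h0] using h
    simp [h0, this]
  · have h' := abs_le.mp h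
    rw [sphTheta, Real.cos_arccos (by rw [le_div_iff₀ h0]; linarith)
      (by rw [div_le_one h0]; exact h'.2)]
    field_simp

lemma norm_mul_sqrt_one_sub_cos_sphTheta_sq (x : E3) :
    ‖x‖ * √(1 - Real.cos (sphTheta x) ^ 2) = ‖planeProj x‖ := by
  rw [← Real.sqrt_sq (norm_nonneg x), ← Real.sqrt_mul (sq_nonneg _),
    planeProj_apply, Complex.norm_def, Complex.normSq_mk]
  have hn := EuclideanSpace.real_norm_sq_eq x
  have hc := norm_mul_cos_sphTheta x
  simp only [Fin.sum_univ_three] at hn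
  congr 1
  rw [← hc] at hn
  linear_combination hn

lemma cos_sphChi (x : E3) : Real.cos (sphChi x) = (‖x‖ ^ 2 - 1) / (‖x‖ ^ 2 + 1) := by
  have h : 0 < ‖x‖ ^ 2 + 1 := by positivity
  exact Real.cos_arccos (by rw [le_div_iff₀ h]; nlinarith [sq_nonneg ‖x‖])
    (by rw [div_le_one h]; linarith)

lemma sin_sphChi (x : E3) : Real.sin (sphChi x) = 2 * ‖x‖ * (1 / (‖x‖ ^ 2 + 1)) := by
  have h : 0 < ‖x‖ ^ 2 + 1 := by positivity
  have e : 1 - ((‖x‖ ^ 2 - 1) / (‖x‖ ^ 2 + 1)) ^ 2 = (2 * ‖x‖ * (1 / (‖x‖ ^ 2 + 1))) ^ 2 := by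
    field_simp
    ring
  rw [sphChi, Real.sin_arccos, e, Real.sqrt_sq (by positivity)]

/-- The angular part of `𝒲_α`, times `|x|^l`, is a solid harmonic. -/
lemma norm_pow_mul_angular (l : ℕ) (m : ℤ) (hm : m.natAbs ≤ l) (x : E3) :
    ‖x‖ ^ l * (√(1 - Real.cos (sphTheta x) ^ 2) ^ m.natAbs *
      (Polynomial.derivative^[l + m.natAbs] ((Polynomial.X ^ 2 - 1 : Polynomial ℝ) ^ l)).eval
        (Real.cos (sphTheta x)) * ymfun m (sphPhi x))
      = solidHarmonic (azimuthConst m) l m.natAbs x := by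
  have hy := norm_pow_mul_ymfun m (planeProj x)
  have hφ : sphPhi x = (planeProj x).arg := by rw [planeProj_apply]; rfl
  rw [← hφ, ← norm_mul_sqrt_one_sub_cos_sphTheta_sq, mul_pow] at hy
  rw [eval_iterate_derivative_X_sq_sub_one_pow]
  have hL : ‖x‖ ^ (l - m.natAbs) * ∑ p ∈ Finset.range (l + 1),
      legendreCoeff l m.natAbs p * Real.cos (sphTheta x) ^ (l - m.natAbs - 2 * p)
      = ∑ p ∈ Finset.range (l + 1), legendreCoeff l m.natAbs p
        * ((‖x‖ ^ 2) ^ p * x 2 ^ (l - m.natAbs - 2 * p)) := by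
    rw [Finset.mul_sum]
    refine Finset.sum_congr rfl fun p hp => ?_
    rcases lt_or_ge l (m.natAbs + 2 * p) with h | h
    · simp [legendreCoeff_eq_zero (Finset.mem_range_succ_iff.mp hp) h]
    · rw [← norm_mul_cos_sphTheta x, mul_pow, ← pow_mul]
      have : ‖x‖ ^ (l - m.natAbs) = ‖x‖ ^ (2 * p) * ‖x‖ ^ (l - m.natAbs - 2 * p) := by
        rw [← pow_add]
        congr 1
        omega
      rw [this]
      ring
  have hs : solidHarmonic (azimuthConst m) l m.natAbs x
      = (azimuthConst m * planeProj x ^ m.natAbs).re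
        * ∑ p ∈ Finset.range (l + 1), legendreCoeff l m.natAbs p
          * ((‖x‖ ^ 2) ^ p * x 2 ^ (l - m.natAbs - 2 * p)) := by
    rw [Finset.mul_sum]
    refine Finset.sum_congr rfl fun p _ => ?_
    simp only [solidMonomial, cylMonomial]
    ring
  rw [hs, ← hL, ← hy]
  have : ‖x‖ ^ l = ‖x‖ ^ m.natAbs * ‖x‖ ^ (l - m.natAbs) := by
    rw [← pow_add, Nat.add_sub_cancel' hm]
  rw [this]
  ring

lemma Wfun_eq (k l : ℕ) (m : ℤ) (hm : m.natAbs ≤ l) :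
    ∃ C : ℝ, Wfun (k, l, m) = fun x => C * (radialProfile l
      (Polynomial.derivative^[l + 1] (Polynomial.Chebyshev.T ℝ ((k + 1 : ℕ) : ℤ))) (‖x‖ ^ 2)
        * solidHarmonic (azimuthConst m) l m.natAbs x) := by
  refine ⟨1 / √(akl k l) * 2 ^ l * √((2 * l + 1) / (2 * π)) * ((-1) ^ m.natAbs
    * √((l - m.natAbs).factorial / (l + m.natAbs).factorial)
      * ((-1) ^ m.natAbs / (2 ^ l * l.factorial))), ?_⟩
  funext x
  rw [← norm_pow_mul_angular l m hm x]
  simp only [Wfun, Yfun, Y2fun, Kfun, legendreP, chebDeriv, radialProfile, cos_sphChi, sin_sphChi,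
    mul_pow]
  ring

/-- For every `k ≥ 0` and `α ∈ Λ_k`, the Arar–Boulmezaoud function satisfies
`-Δ𝒲_α(x) = ((2k+1)(2k+3)/(|x|²+1)²) 𝒲_α(x)` for all `x ∈ ℝ³`. -/
theorem AB_eigen_equation (k : ℕ) (α : ℕ × ℕ × ℤ) (hα : memLam α) (hk : α.1 = k) (x : E3) :
    - laplacian (Wfun α) x
      = (((2*(k:ℝ)+1) * (2*(k:ℝ)+3)) / (‖x‖^2+1)^2) * Wfun α x := by
  obtain ⟨k', l, m⟩ := α
  obtain rfl : k' = k := hk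
  obtain ⟨C, hC⟩ := Wfun_eq k' l m hα.2
  set Q := Polynomial.derivative^[l + 1] (Polynomial.Chebyshev.T ℝ ((k' + 1 : ℕ) : ℤ)) with hQ
  have hF (s : ℝ) (hs : 0 ≤ s) := (hasDerivAt_radialProfile l Q hs).const_mul C
  have hF₁ (s : ℝ) (hs : 0 ≤ s) :=
    (((hasDerivAt_radialProfile (l + 1) Q hs).const_mul (-((l : ℝ) + 1 / 2))).fun_add
      ((hasDerivAt_radialProfile (l + 2) Q.derivative hs).const_mul 2)).const_mul C
  have hmul := laplacian_radial_mul hF hF₁ (contDiff_solidHarmonic (azimuthConst m) l m.natAbs)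
    (euler_solidHarmonic (azimuthConst m) l m.natAbs) x
  have ode := radialProfile_chebyshev_ode k' l (sq_nonneg ‖x‖)
  simp only [← hQ] at ode
  simp only [mul_assoc C] at hmul
  rw [hC, hmul, laplacian_solidHarmonic]
  linear_combination -C * solidHarmonic (azimuthConst m) l m.natAbs x * ode

end
end

section
/- For all indices α = (k,ℓ,m) ∈ Λ and β = (k',ℓ',m') ∈ Λ, the weighted orthogonality relation ∫_{ℝ³} 𝒲_α(x) 𝒲_β(x) / (|x|²+1)² dx = (1/4) δ_{αβ} holds, where δ_{αβ} = δ_{kk'} δ_{ℓℓ'} δ_{mm'} is the Kronecker symbol. -/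
open MeasureTheory Real Filter Metric
open scoped RealInnerProductSpace BigOperators

noncomputable section

section LadderIdentities

open Polynomial

/-- Integration by parts for a solution of a Gegenbauer-type equation, in the variable
`x = cos θ`. -/
lemma integral_sin_pow_mul_derivative_mul_derivative (n : ℕ) (c : ℝ) (p q : ℝ[X])
    (hp : ∀ x : ℝ, (1 - x ^ 2) * (derivative (derivative p)).eval x
      = (n + 1) * x * (derivative p).eval x - c * p.eval x) :
    ∫ θ in (0)..π, sin θ ^ (n + 2) * ((derivative p).eval (cos θ) * (derivative q).eval (cos θ))
      = c * ∫ θ in (0)..π, sin θ ^ n * (p.eval (cos θ) * q.eval (cos θ)) := by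
  have hderiv : ∀ θ : ℝ, HasDerivAt
      (fun θ => sin θ ^ (n + 1) * (derivative p).eval (cos θ) * q.eval (cos θ))
      (c * (sin θ ^ n * (p.eval (cos θ) * q.eval (cos θ)))
        - sin θ ^ (n + 2) * ((derivative p).eval (cos θ) * (derivative q).eval (cos θ))) θ := by
    intro θ
    have h1 := (hasDerivAt_sin θ).pow (n + 1)
    have h2 := ((derivative p).hasDerivAt (cos θ)).comp θ (hasDerivAt_cos θ)
    have h3 := (q.hasDerivAt (cos θ)).comp θ (hasDerivAt_cos θ)
    refine ((h1.mul h2).mul h3).congr_deriv ?_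
    have h4 := hp (cos θ)
    have h5 : 1 - cos θ ^ 2 = sin θ ^ 2 := by rw [← sin_sq_add_cos_sq θ]; ring
    rw [h5] at h4
    simp only [Pi.mul_apply, Pi.pow_apply, Function.comp_apply, Nat.add_sub_cancel]
    push_cast
    linear_combination (-sin θ ^ n * q.eval (cos θ)) * h4
  have hint := intervalIntegral.integral_eq_sub_of_hasDerivAt (a := 0) (b := π)
    (fun θ _ => hderiv θ) (Continuous.intervalIntegrable (by fun_prop) _ _)
  rw [intervalIntegral.integral_sub (Continuous.intervalIntegrable (by fun_prop) _ _)
    (Continuous.intervalIntegrable (by fun_prop) _ _),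
    intervalIntegral.integral_const_mul] at hint
  simp only [sin_pi, sin_zero, ne_eq, Nat.add_eq_zero_iff, one_ne_zero, and_false,
    not_false_eq_true, zero_pow, zero_mul, sub_self] at hint
  linarith

/-- Solutions of the same Gegenbauer-type equation with distinct eigenvalues are orthogonal. -/
lemma integral_sin_pow_mul_eq_zero (n : ℕ) {c d : ℝ} (hcd : c ≠ d) (p q : ℝ[X])
    (hp : ∀ x : ℝ, (1 - x ^ 2) * (derivative (derivative p)).eval x
      = (n + 1) * x * (derivative p).eval x - c * p.eval x)
    (hq : ∀ x : ℝ, (1 - x ^ 2) * (derivative (derivative q)).eval x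
      = (n + 1) * x * (derivative q).eval x - d * q.eval x) :
    ∫ θ in (0)..π, sin θ ^ n * (p.eval (cos θ) * q.eval (cos θ)) = 0 := by
  have h1 := integral_sin_pow_mul_derivative_mul_derivative n c p q hp
  have h2 := integral_sin_pow_mul_derivative_mul_derivative n d q p hq
  simp only [mul_comm (eval _ q), mul_comm (eval _ (derivative q))] at h2
  have h3 := h1.symm.trans h2
  exact (mul_eq_mul_right_iff.mp h3).resolve_left hcd

lemma chebyshev_T_ode (n j : ℕ) (x : ℝ) :
    (1 - x ^ 2) * (derivative (derivative (derivative^[j] (Chebyshev.T ℝ n)))).eval x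
      = (((2 * j : ℕ) : ℝ) + 1) * x * (derivative (derivative^[j] (Chebyshev.T ℝ n))).eval x
        - ((n : ℝ) ^ 2 - j ^ 2) * (derivative^[j] (Chebyshev.T ℝ n)).eval x := by
  have h := Chebyshev.one_sub_X_sq_mul_iterate_derivative_T_eval (R := ℝ) (n : ℤ) j x
  simp only [Function.iterate_succ_apply'] at h
  push_cast at h ⊢
  exact h

lemma integral_sin_pow_mul_iterate_derivative_T_of_ne {n n' : ℕ} (h : n ≠ n') (j : ℕ) :
    ∫ θ in (0)..π, sin θ ^ (2 * j) * ((derivative^[j] (Chebyshev.T ℝ n)).eval (cos θ)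
      * (derivative^[j] (Chebyshev.T ℝ n')).eval (cos θ)) = 0 := by
  refine integral_sin_pow_mul_eq_zero (2 * j) ?_ _ _ (chebyshev_T_ode n j) (chebyshev_T_ode n' j)
  intro he
  have : (n : ℝ) ^ 2 = (n' : ℝ) ^ 2 := by linarith
  exact h (by exact_mod_cast (pow_left_inj₀ (by positivity) (by positivity) two_ne_zero).mp this)

lemma integral_sin_pow_mul_iterate_derivative_T_self (k j : ℕ) (hj : j ≤ k + 1) :
    ∫ θ in (0)..π, sin θ ^ (2 * j) * ((derivative^[j] (Chebyshev.T ℝ (k + 1 : ℕ))).eval (cos θ)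
      * (derivative^[j] (Chebyshev.T ℝ (k + 1 : ℕ))).eval (cos θ))
      = π / 2 * (k + 1) * (k + j).factorial / (k + 1 - j).factorial := by
  induction j with
  | zero =>
    have h := Chebyshev.integral_T_real_mul_self_measureT_of_ne_zero (n := k + 1) (by omega)
    rw [Chebyshev.integral_measureT_eq_integral_cos] at h
    simp only [mul_zero, pow_zero, one_mul, Function.iterate_zero, id_eq, add_zero, Nat.sub_zero]
    rw [h, Nat.factorial_succ]
    have := Nat.factorial_ne_zero k
    push_cast
    field_simp
  | succ j ih =>
    have h := integral_sin_pow_mul_derivative_mul_derivative (2 * j) _ _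
      (derivative^[j] (Chebyshev.T ℝ (k + 1 : ℕ))) (chebyshev_T_ode (k + 1) j)
    simp only [← Function.iterate_succ_apply'] at h
    rw [show 2 * (j + 1) = 2 * j + 2 by ring, h, ih (by omega)]
    obtain ⟨d, rfl⟩ : ∃ d, k = j + d := ⟨k - j, by omega⟩
    rw [show j + d + 1 - j = d + 1 by omega, show j + d + 1 - (j + 1) = d by omega,
      show j + d + (j + 1) = j + d + j + 1 by ring, Nat.factorial_succ d,
      Nat.factorial_succ (j + d + j)]
    have := Nat.factorial_ne_zero d
    push_cast
    field_simp
    ring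

lemma iterate_derivative_X_sq_sub_one_pow_ode (l j : ℕ) :
    (1 - X ^ 2) * derivative^[j + 2] ((X ^ 2 - 1 : ℝ[X]) ^ l)
      = (2 * j + 2 - 2 * l : ℝ[X]) * X * derivative^[j + 1] ((X ^ 2 - 1 : ℝ[X]) ^ l)
        - ((2 * l - j) * (j + 1) : ℝ[X]) * derivative^[j] ((X ^ 2 - 1 : ℝ[X]) ^ l) := by
  induction j with
  | zero =>
    have h1 : (X ^ 2 - 1) * derivative ((X ^ 2 - 1 : ℝ[X]) ^ l)
        = (2 * l : ℝ[X]) * X * (X ^ 2 - 1 : ℝ[X]) ^ l := by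
      rcases l with _ | l
      · simp
      · simp only [derivative_pow, derivative_sub, derivative_X, derivative_one,
          Nat.add_sub_cancel, Nat.cast_ofNat, map_ofNat, map_natCast]
        push_cast
        ring
    have h2 := congrArg derivative h1
    simp only [derivative_mul, derivative_sub, derivative_X_pow, derivative_one, derivative_X,
      derivative_natCast, derivative_ofNat, Nat.cast_ofNat] at h2
    simp only [Function.iterate_succ_apply', Function.iterate_zero, id_eq]
    simp only [map_ofNat] at h2
    push_cast
    linear_combination -h2
  | succ j ih =>
    have h2 := congrArg derivative ih
    simp only [derivative_mul, derivative_sub, derivative_add, derivative_X_pow, derivative_one,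
      derivative_X, derivative_natCast, derivative_ofNat, Nat.cast_ofNat, map_ofNat,
      ← Function.iterate_succ_apply' derivative] at h2
    simp only [Nat.succ_eq_add_one] at h2
    push_cast
    linear_combination h2

lemma legendre_ode (l m : ℕ) (x : ℝ) :
    (1 - x ^ 2) *
        (derivative (derivative (derivative^[l + m] ((X ^ 2 - 1 : ℝ[X]) ^ l)))).eval x
      = (((2 * m + 1 : ℕ) : ℝ) + 1) * x *
          (derivative (derivative^[l + m] ((X ^ 2 - 1 : ℝ[X]) ^ l))).eval x
        - (((l : ℝ) - m) * (l + m + 1)) *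
          (derivative^[l + m] ((X ^ 2 - 1 : ℝ[X]) ^ l)).eval x := by
  have h := congrArg (eval x) (iterate_derivative_X_sq_sub_one_pow_ode l (l + m))
  rw [Function.iterate_succ_apply', Function.iterate_succ_apply'] at h
  generalize derivative^[l + m] ((X ^ 2 - 1 : ℝ[X]) ^ l) = p at h ⊢
  simp only [eval_mul, eval_sub, eval_add, eval_one, eval_pow, eval_X, eval_natCast,
    eval_ofNat] at h
  push_cast at h ⊢
  linear_combination h

lemma integral_sin_pow_mul_legendre_of_ne {l l' : ℕ} (h : l ≠ l') (m : ℕ) :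
    ∫ θ in (0)..π, sin θ ^ (2 * m + 1) *
      ((derivative^[l + m] ((X ^ 2 - 1 : ℝ[X]) ^ l)).eval (cos θ)
        * (derivative^[l' + m] ((X ^ 2 - 1 : ℝ[X]) ^ l')).eval (cos θ)) = 0 := by
  refine integral_sin_pow_mul_eq_zero (2 * m + 1) ?_ _ _ (legendre_ode l m) (legendre_ode l' m)
  intro he
  have h1 : ((l : ℝ) - l') * (l + l' + 1) = 0 := by linarith
  rcases mul_eq_zero.mp h1 with h1 | h1
  · exact h (by exact_mod_cast sub_eq_zero.mp h1)
  · exact absurd h1 (by positivity)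

lemma iterate_derivative_X_sq_sub_one_pow_top (l : ℕ) :
    derivative^[l + l] ((X ^ 2 - 1 : ℝ[X]) ^ l) = C ((2 * l).factorial : ℝ) := by
  have hmonic : ((X ^ 2 - 1 : ℝ[X]) ^ l).Monic := (monic_X_pow_sub_C 1 two_ne_zero).pow l
  have hdeg : ((X ^ 2 - 1 : ℝ[X]) ^ l).natDegree = 2 * l := by
    have : (X ^ 2 - 1 : ℝ[X]).natDegree = 2 := natDegree_X_pow_sub_C (r := (1 : ℝ))
    rw [natDegree_pow, this, mul_comm]
  rw [eq_C_of_natDegree_eq_zero (p := derivative^[l + l] ((X ^ 2 - 1 : ℝ[X]) ^ l))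
    (Nat.le_zero.mp ((natDegree_iterate_derivative _ _).trans (by omega))),
    coeff_iterate_derivative, zero_add, ← two_mul, Nat.descFactorial_self, ← hdeg,
    hmonic.coeff_natDegree, nsmul_one]

lemma factorial_mul_integral_sin_pow_odd (l : ℕ) :
    ((2 * l).factorial : ℝ) * (2 * l + 1) * ∫ θ in (0)..π, sin θ ^ (2 * l + 1)
      = 2 * (2 ^ l * l.factorial) ^ 2 := by
  rw [integral_sin_pow_odd]
  induction l with
  | zero => simp
  | succ l ih =>
    rw [Finset.prod_range_succ, show 2 * (l + 1) = 2 * l + 1 + 1 by ring, Nat.factorial_succ,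
      Nat.factorial_succ, Nat.factorial_succ l]
    push_cast at ih ⊢
    have h3 : (2 * (l : ℝ) + 3) ≠ 0 := by positivity
    have e : ((2 * (l : ℝ) + 1 + 1) * ((2 * l + 1) * ((2 * l).factorial : ℝ))) * (2 * (l + 1) + 1) *
        (2 * ((∏ i ∈ Finset.range l, (2 * (i : ℝ) + 2) / (2 * i + 3)) *
          ((2 * (l : ℝ) + 2) / (2 * l + 3))))
        = (2 * (l : ℝ) + 2) ^ 2 * (((2 * l).factorial : ℝ) * (2 * l + 1) *
          (2 * ∏ i ∈ Finset.range l, (2 * (i : ℝ) + 2) / (2 * i + 3))) := by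
      field_simp
      ring
    rw [e, ih]
    ring

lemma integral_sin_pow_mul_legendre_self (l m : ℕ) (hm : m ≤ l) :
    ∫ θ in (0)..π, sin θ ^ (2 * m + 1) *
      ((derivative^[l + m] ((X ^ 2 - 1 : ℝ[X]) ^ l)).eval (cos θ)
        * (derivative^[l + m] ((X ^ 2 - 1 : ℝ[X]) ^ l)).eval (cos θ))
      = 2 / (2 * l + 1) * (2 ^ l * l.factorial) ^ 2 * (l + m).factorial / (l - m).factorial := by
  induction hm using Nat.decreasingInduction with
  | self =>
    simp only [iterate_derivative_X_sq_sub_one_pow_top, eval_C, Nat.sub_self]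
    rw [intervalIntegral.integral_mul_const, show l + l = 2 * l by ring]
    have h := factorial_mul_integral_sin_pow_odd l
    have h2 : (2 * (l : ℝ) + 1) ≠ 0 := by positivity
    simp only [Nat.factorial_zero, Nat.cast_one]
    field_simp
    linear_combination h
  | of_succ m hm ih =>
    have h := integral_sin_pow_mul_derivative_mul_derivative (2 * m + 1) _ _
      (derivative^[l + m] ((X ^ 2 - 1 : ℝ[X]) ^ l)) (legendre_ode l m)
    simp only [← Function.iterate_succ_apply'] at h
    rw [show 2 * (m + 1) + 1 = 2 * m + 1 + 2 by ring, ← add_assoc, h] at ih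
    obtain ⟨d, rfl⟩ : ∃ d, l = m + 1 + d := ⟨l - (m + 1), by omega⟩
    rw [show m + 1 + d - m = d + 1 by omega]
    rw [show m + 1 + d - (m + 1) = d by omega, Nat.factorial_succ (m + 1 + d + m)] at ih
    rw [Nat.factorial_succ d]
    have h1 := Nat.factorial_ne_zero d
    generalize (∫ θ in (0)..π, _ : ℝ) = I at ih ⊢
    have h3 : (2 * ((m : ℝ) + 1 + d) + 1) ≠ 0 := by positivity
    push_cast at ih ⊢
    field_simp at ih ⊢
    linear_combination ih

end LadderIdentities

section SphericalCoordinates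

/-- The measure `r dr` on the half-line `(0, ∞)`. -/
def radialMeasure : Measure ℝ := volume.withDensity ENNReal.ofReal

/-- The measure `dφ` on `(-π, π)`. -/
def angleMeasure : Measure ℝ := volume.restrict (Set.Ioo (-π) π)

/-- The measure `sin θ dθ` on `(0, π)`. -/
def polarAngleMeasure : Measure ℝ := angleMeasure.withDensity fun θ => ENNReal.ofReal (sin θ)

instance : SFinite radialMeasure := by unfold radialMeasure; infer_instance
instance : SFinite angleMeasure := by unfold angleMeasure; infer_instance
instance : SFinite polarAngleMeasure := by unfold polarAngleMeasure; infer_instance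

lemma MeasureTheory.MeasurePreserving.withDensity_comp {X Y : Type*} [MeasurableSpace X]
    [MeasurableSpace Y] {μ : Measure X} {ν : Measure Y} {f : X → Y}
    (hf : MeasurePreserving f μ ν) {g : Y → ENNReal} (hg : Measurable g) :
    MeasurePreserving f (μ.withDensity (g ∘ f)) (ν.withDensity g) := by
  refine ⟨hf.measurable, Measure.ext fun s hs => ?_⟩
  rw [Measure.map_apply hf.measurable hs, withDensity_apply _ (hf.measurable hs),
    withDensity_apply _ hs, ← hf.setLIntegral_comp_preimage hs hg]
  rfl

lemma radialMeasure_eq_restrict :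
    radialMeasure = (volume.restrict (Set.Ioi 0)).withDensity ENNReal.ofReal := by
  rw [radialMeasure, ← withDensity_indicator measurableSet_Ioi]
  congr 1
  ext r
  by_cases hr : 0 < r
  · simp [hr]
  · simp [hr, ENNReal.ofReal_of_nonpos (not_lt.mp hr)]

lemma ae_radialMeasure_pos : ∀ᵐ r ∂radialMeasure, 0 < r := by
  rw [radialMeasure_eq_restrict]
  exact (withDensity_absolutelyContinuous _ _).ae_le (ae_restrict_mem measurableSet_Ioi)

lemma measurePreserving_polarCoord_symm :
    MeasurePreserving (fun p : ℝ × ℝ => (p.1 * cos p.2, p.1 * sin p.2))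
      (radialMeasure.prod angleMeasure) volume := by
  have hm : Measurable (fun p : ℝ × ℝ => (p.1 * cos p.2, p.1 * sin p.2)) := by fun_prop
  refine ⟨hm, Measure.ext fun s hs => ?_⟩
  rw [Measure.map_apply hm hs, radialMeasure_eq_restrict, angleMeasure,
    prod_withDensity_left (by fun_prop), Measure.prod_restrict, withDensity_apply _ (hm hs),
    ← lintegral_indicator_one hs, ← lintegral_comp_polarCoord_symm, ← lintegral_indicator (hm hs)]
  refine lintegral_congr fun p => ?_
  by_cases hp : (p.1 * cos p.2, p.1 * sin p.2) ∈ s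
  · simp [Set.indicator, hp]
  · simp [Set.indicator, hp]

lemma measurePreserving_polarAngle :
    MeasurePreserving (fun p : ℝ × ℝ => (p.1 * cos p.2, p.1 * sin p.2))
      ((radialMeasure.withDensity ENNReal.ofReal).prod polarAngleMeasure)
      (volume.prod radialMeasure) := by
  have h := measurePreserving_polarCoord_symm.withDensity_comp
    (g := fun q : ℝ × ℝ => ENNReal.ofReal q.2) (by fun_prop)
  rw [polarAngleMeasure, prod_withDensity (by fun_prop) (by fun_prop)]
  have hv : volume.prod radialMeasure
      = (volume : Measure (ℝ × ℝ)).withDensity fun q => ENNReal.ofReal q.2 := by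
    rw [radialMeasure, prod_withDensity_right (by fun_prop)]
    rfl
  rw [hv]
  refine (congrArg (fun μ => MeasurePreserving _ μ _) (withDensity_congr_ae ?_)).mpr h
  filter_upwards [Measure.quasiMeasurePreserving_fst.ae ae_radialMeasure_pos] with p hp
  simp [ENNReal.ofReal_mul hp.le]

/-- Spherical coordinates `(r, θ, φ)` on `ℝ³`. -/
def sphericalPoint (p : (ℝ × ℝ) × ℝ) : E3 :=
  !₂[p.1.1 * sin p.1.2 * cos p.2, p.1.1 * sin p.1.2 * sin p.2, p.1.1 * cos p.1.2]

lemma measurePreserving_toE3 :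
    MeasurePreserving (fun q : ℝ × (ℝ × ℝ) => (!₂[q.2.1, q.2.2, q.1] : E3))
      (volume.prod (volume : Measure (ℝ × ℝ))) volume := by
  have h1 := (volume_preserving_piFinSuccAbove (fun _ : Fin 3 => ℝ) 2).symm
  have h2 := (MeasurePreserving.id (volume : Measure ℝ)).prod
    (volume_preserving_finTwoArrow ℝ).symm
  have h3 := (PiLp.volume_preserving_toLp (Fin 3)).comp (h1.comp h2)
  have heq : (fun q : ℝ × (ℝ × ℝ) => (!₂[q.2.1, q.2.2, q.1] : E3)) = WithLp.toLp 2 ∘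
      (MeasurableEquiv.piFinSuccAbove (fun _ : Fin 3 => ℝ) 2).symm ∘
        Prod.map id MeasurableEquiv.finTwoArrow.symm := by
    funext q
    ext i
    fin_cases i <;> rfl
  rw [heq]
  exact h3

lemma measurePreserving_sphericalPoint :
    MeasurePreserving sphericalPoint
      (((radialMeasure.withDensity ENNReal.ofReal).prod polarAngleMeasure).prod angleMeasure)
      volume := by
  have h1 := measurePreserving_polarAngle.prod (MeasurePreserving.id angleMeasure)
  have h2 := measurePreserving_prodAssoc (volume : Measure ℝ) radialMeasure angleMeasure
  have h3 := (MeasurePreserving.id (volume : Measure ℝ)).prod measurePreserving_polarCoord_symm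
  exact measurePreserving_toE3.comp (h3.comp (h2.comp h1))

lemma ae_sphericalCoordinates_mem :
    ∀ᵐ p ∂((radialMeasure.withDensity ENNReal.ofReal).prod polarAngleMeasure).prod angleMeasure,
      0 < p.1.1 ∧ p.1.2 ∈ Set.Ioo 0 π ∧ p.2 ∈ Set.Ioo (-π) π := by
  have hr : ∀ᵐ r ∂radialMeasure.withDensity ENNReal.ofReal, 0 < r :=
    (withDensity_absolutelyContinuous _ _).ae_le ae_radialMeasure_pos
  have hφ : ∀ᵐ φ ∂angleMeasure, φ ∈ Set.Ioo (-π) π := ae_restrict_mem measurableSet_Ioo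
  have hθ : ∀ᵐ θ ∂polarAngleMeasure, θ ∈ Set.Ioo 0 π := by
    rw [polarAngleMeasure, ae_withDensity_iff (by fun_prop)]
    filter_upwards [hφ] with θ hθ hne
    refine ⟨?_, hθ.2⟩
    by_contra hle
    exact hne (ENNReal.ofReal_of_nonpos
      (sin_nonpos_of_nonpos_of_neg_pi_le (not_lt.mp hle) hθ.1.le))
  have hrθ : ∀ᵐ q ∂(radialMeasure.withDensity ENNReal.ofReal).prod polarAngleMeasure,
      0 < q.1 ∧ q.2 ∈ Set.Ioo 0 π :=
    (Measure.quasiMeasurePreserving_fst.ae hr).and (Measure.quasiMeasurePreserving_snd.ae hθ)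
  filter_upwards [Measure.quasiMeasurePreserving_fst.ae hrθ,
    Measure.quasiMeasurePreserving_snd.ae hφ] with p h1 h2 using ⟨h1.1, h1.2, h2⟩

lemma integral_radialMeasure_withDensity (f : ℝ → ℝ) :
    ∫ r, f r ∂radialMeasure.withDensity ENNReal.ofReal = ∫ r in Set.Ioi 0, r ^ 2 * f r := by
  rw [integral_withDensity_eq_integral_toReal_smul (by fun_prop) (by simp),
    radialMeasure_eq_restrict,
    integral_withDensity_eq_integral_toReal_smul (by fun_prop) (by simp)]
  refine setIntegral_congr_fun measurableSet_Ioi fun r hr => ?_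
  simp only [ENNReal.toReal_ofReal (Set.mem_Ioi.mp hr).le, smul_eq_mul]
  ring

lemma integral_polarAngleMeasure (f : ℝ → ℝ) :
    ∫ θ, f θ ∂polarAngleMeasure = ∫ θ in (0)..π, sin θ * f θ := by
  rw [polarAngleMeasure, integral_withDensity_eq_integral_toReal_smul (by fun_prop) (by simp),
    angleMeasure, intervalIntegral.integral_of_le pi_pos.le, integral_Ioc_eq_integral_Ioo,
    ← integral_indicator measurableSet_Ioo, ← integral_indicator measurableSet_Ioo]
  congr 1
  ext θ
  by_cases h1 : θ ∈ Set.Ioo 0 π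
  · have h2 : θ ∈ Set.Ioo (-π) π := ⟨by linarith [h1.1, pi_pos], h1.2⟩
    simp only [Set.indicator_of_mem h1, Set.indicator_of_mem h2,
      ENNReal.toReal_ofReal (sin_pos_of_mem_Ioo h1).le, smul_eq_mul]
  · rw [Set.indicator_of_notMem h1]
    by_cases h2 : θ ∈ Set.Ioo (-π) π
    · have h3 : θ ≤ 0 := by
        by_contra h
        exact h1 ⟨not_le.mp h, h2.2⟩
      rw [Set.indicator_of_mem h2,
        ENNReal.ofReal_of_nonpos (sin_nonpos_of_nonpos_of_neg_pi_le h3 h2.1.le)]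
      simp
    · rw [Set.indicator_of_notMem h2]

lemma integral_angleMeasure (f : ℝ → ℝ) :
    ∫ φ, f φ ∂angleMeasure = ∫ φ in (-π)..π, f φ := by
  rw [angleMeasure, intervalIntegral.integral_of_le (by linarith [pi_pos]),
    integral_Ioc_eq_integral_Ioo]

/-- The integral of a function that separates in spherical coordinates. -/
lemma integral_eq_of_separated {F : E3 → ℝ} (hF : Measurable F) {f g h : ℝ → ℝ}
    (hsep : ∀ r θ φ, 0 < r → θ ∈ Set.Ioo 0 π → φ ∈ Set.Ioo (-π) π →
      F (sphericalPoint ((r, θ), φ)) = f r * g θ * h φ) :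
    ∫ x, F x = (∫ r in Set.Ioi 0, r ^ 2 * f r) * (∫ θ in (0)..π, sin θ * g θ)
      * ∫ φ in (-π)..π, h φ := by
  rw [← measurePreserving_sphericalPoint.map_eq,
    integral_map measurePreserving_sphericalPoint.aemeasurable hF.aestronglyMeasurable,
    integral_congr_ae (g := fun p => f p.1.1 * g p.1.2 * h p.2),
    integral_prod_mul (fun q : ℝ × ℝ => f q.1 * g q.2) h, integral_prod_mul f g,
    integral_radialMeasure_withDensity, integral_polarAngleMeasure, integral_angleMeasure]
  filter_upwards [ae_sphericalCoordinates_mem] with p hp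
  exact hsep p.1.1 p.1.2 p.2 hp.1 hp.2.1 hp.2.2

end SphericalCoordinates

section TrigonometricIntegrals

lemma integral_cos_int_mul (n : ℤ) :
    ∫ φ in (-π)..π, cos (n * φ) = if n = 0 then 2 * π else 0 := by
  split_ifs with hn
  · simp [hn]
    ring
  · rw [intervalIntegral.integral_comp_mul_left (fun x => cos x) (by exact_mod_cast hn)]
    simp

lemma integral_sin_int_mul (n : ℤ) : ∫ φ in (-π)..π, sin (n * φ) = 0 := by
  rcases eq_or_ne n 0 with rfl | hn
  · simp
  · rw [intervalIntegral.integral_comp_mul_left (fun x => sin x) (by exact_mod_cast hn)]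
    simp

lemma integral_cos_int_mul_cos (m n : ℤ) :
    ∫ φ in (-π)..π, cos (m * φ) * cos (n * φ)
      = ((if m - n = 0 then 2 * π else 0) + (if m + n = 0 then 2 * π else 0)) / 2 := by
  rw [← integral_cos_int_mul, ← integral_cos_int_mul, ← intervalIntegral.integral_add
    (Continuous.intervalIntegrable (by fun_prop) _ _)
    (Continuous.intervalIntegrable (by fun_prop) _ _), ← intervalIntegral.integral_div]
  congr 1
  ext φ
  push_cast
  rw [sub_mul, add_mul, cos_sub, cos_add]
  ring

lemma integral_sin_int_mul_sin (m n : ℤ) :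
    ∫ φ in (-π)..π, sin (m * φ) * sin (n * φ)
      = ((if m - n = 0 then 2 * π else 0) - (if m + n = 0 then 2 * π else 0)) / 2 := by
  rw [← integral_cos_int_mul, ← integral_cos_int_mul, ← intervalIntegral.integral_sub
    (Continuous.intervalIntegrable (by fun_prop) _ _)
    (Continuous.intervalIntegrable (by fun_prop) _ _), ← intervalIntegral.integral_div]
  congr 1
  ext φ
  push_cast
  rw [sub_mul, add_mul, cos_sub, cos_add]
  ring

lemma integral_sin_int_mul_cos (m n : ℤ) :
    ∫ φ in (-π)..π, sin (m * φ) * cos (n * φ) = 0 := by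
  have h : ∀ φ : ℝ, sin (m * φ) * cos (n * φ)
      = (sin ((m - n : ℤ) * φ) + sin ((m + n : ℤ) * φ)) / 2 := by
    intro φ
    push_cast
    rw [sub_mul, add_mul, sin_sub, sin_add]
    ring
  simp only [h]
  rw [intervalIntegral.integral_div, intervalIntegral.integral_add
    (Continuous.intervalIntegrable (by fun_prop) _ _)
    (Continuous.intervalIntegrable (by fun_prop) _ _), integral_sin_int_mul, integral_sin_int_mul]
  simp

lemma ymfun_of_nonneg {m : ℤ} (hm : 0 ≤ m) (φ : ℝ) :
    ymfun m φ = (if m = 0 then 1 / √2 else 1) * cos (m * φ) := by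
  unfold ymfun
  split_ifs with h0 h1
  · simp [h0]
  · simp
  · omega

lemma ymfun_of_neg {m : ℤ} (hm : m < 0) (φ : ℝ) : ymfun m φ = sin ((-m : ℤ) * φ) := by
  unfold ymfun
  rw [if_neg (by omega), if_neg (by omega), abs_of_neg hm]

lemma integral_ymfun_mul (m n : ℤ) :
    ∫ φ in (-π)..π, ymfun m φ * ymfun n φ = if m = n then π else 0 := by
  rcases lt_or_ge m 0 with hm | hm <;> rcases lt_or_ge n 0 with hn | hn
  · simp only [ymfun_of_neg hm, ymfun_of_neg hn, integral_sin_int_mul_sin]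
    rw [if_neg (show ¬ -m + -n = 0 by omega)]
    by_cases h : m = n
    · simp [h]
    · rw [if_neg (show ¬ -m - -n = 0 by omega), if_neg h]
      simp
  · simp only [ymfun_of_neg hm, ymfun_of_nonneg hn]
    rw [if_neg (show ¬ m = n by omega)]
    simp only [mul_left_comm (sin _)]
    rw [intervalIntegral.integral_const_mul, integral_sin_int_mul_cos, mul_zero]
  · simp only [ymfun_of_neg hn, ymfun_of_nonneg hm]
    rw [if_neg (show ¬ m = n by omega)]
    simp only [mul_assoc, mul_comm (cos _)]
    rw [intervalIntegral.integral_const_mul, integral_sin_int_mul_cos, mul_zero]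
  · simp only [ymfun_of_nonneg hm, ymfun_of_nonneg hn, mul_mul_mul_comm _ (cos _)]
    rw [intervalIntegral.integral_const_mul, integral_cos_int_mul_cos]
    by_cases h : m = n
    · subst h
      by_cases h0 : m = 0
      · subst h0
        have h2 : (√2) * √2 = 2 := Real.mul_self_sqrt (by norm_num)
        simp only [if_true, sub_self, add_zero]
        field_simp
        linear_combination (-1) * h2
      · rw [if_neg (show ¬ m + m = 0 by omega)]
        simp [h0]
    · rw [if_neg (show ¬ m - n = 0 by omega), if_neg (show ¬ m + n = 0 by omega), if_neg h]
      simp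

end TrigonometricIntegrals

section RadialSubstitution

/-- The substitution `r = cot (χ / 2)`. -/
lemma integral_Ioi_comp_pi_sub_two_mul_arctan (g : ℝ → ℝ) :
    ∫ r in Set.Ioi (0 : ℝ), 2 / (1 + r ^ 2) * g (π - 2 * arctan r) = ∫ χ in (0)..π, g χ := by
  have himg : (fun r => π - 2 * arctan r) '' Set.Ioi 0 = Set.Ioo 0 π := by
    ext χ
    constructor
    · rintro ⟨r, hr, rfl⟩
      have h1 := arctan_lt_pi_div_two r
      have h2 := arctan_pos.mpr hr
      constructor <;> dsimp only <;> linarith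
    · rintro ⟨h0, hπ⟩
      refine ⟨tan ((π - χ) / 2), tan_pos_of_pos_of_lt_pi_div_two (by linarith) (by linarith), ?_⟩
      dsimp only
      rw [arctan_tan (by linarith) (by linarith)]
      ring
  have hderiv : ∀ r ∈ Set.Ioi (0 : ℝ),
      HasDerivWithinAt (fun r => π - 2 * arctan r) (-(2 * (1 / (1 + r ^ 2)))) (Set.Ioi 0) r :=
    fun r _ => (((hasDerivAt_arctan r).const_mul 2).const_sub π).hasDerivWithinAt
  have hinj : Set.InjOn (fun r => π - 2 * arctan r) (Set.Ioi 0) := by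
    intro a _ b _ hab
    exact arctan_injective (by dsimp only at hab; linarith)
  rw [intervalIntegral.integral_of_le pi_pos.le, integral_Ioc_eq_integral_Ioo, ← himg,
    integral_image_eq_integral_abs_deriv_smul measurableSet_Ioi hderiv hinj]
  refine setIntegral_congr_fun measurableSet_Ioi fun r _ => ?_
  rw [abs_neg, abs_of_pos (by positivity), smul_eq_mul]
  ring

lemma arccos_stereographic {r : ℝ} (hr : 0 < r) :
    arccos ((r ^ 2 - 1) / (r ^ 2 + 1)) = π - 2 * arctan r := by
  have h1 := arctan_lt_pi_div_two r
  have h2 := arctan_pos.mpr hr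
  refine arccos_eq_of_eq_cos (by linarith) (by linarith) ?_
  rw [cos_pi_sub, cos_two_mul, cos_sq_arctan]
  field_simp
  ring

lemma sin_arccos_stereographic {r : ℝ} (hr : 0 < r) :
    sin (arccos ((r ^ 2 - 1) / (r ^ 2 + 1))) = 2 * r / (r ^ 2 + 1) := by
  rw [sin_arccos, show 1 - ((r ^ 2 - 1) / (r ^ 2 + 1)) ^ 2 = (2 * r / (r ^ 2 + 1)) ^ 2 by
    field_simp; ring]
  exact Real.sqrt_sq (by positivity)

lemma integral_stereographic (g : ℝ → ℝ) :
    ∫ r in Set.Ioi (0 : ℝ), r ^ 2 * (2 / (r ^ 2 + 1) ^ 3 * g (arccos ((r ^ 2 - 1) / (r ^ 2 + 1))))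
      = 1 / 4 * ∫ χ in (0)..π, sin χ ^ 2 * g χ := by
  rw [← integral_Ioi_comp_pi_sub_two_mul_arctan, ← integral_const_mul]
  refine setIntegral_congr_fun measurableSet_Ioi fun r hr => ?_
  rw [← arccos_stereographic hr, sin_arccos_stereographic hr]
  field_simp
  ring

end RadialSubstitution

section NormalizedFactors

open Polynomial

lemma Kfun_cos (l m : ℕ) {θ : ℝ} (hθ : θ ∈ Set.Icc 0 π) :
    Kfun l m (cos θ) = √((l - m).factorial / (l + m).factorial) / (2 ^ l * l.factorial) *
      (sin θ ^ m * (derivative^[l + m] ((X ^ 2 - 1 : ℝ[X]) ^ l)).eval (cos θ)) := by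
  have hs : √(1 - cos θ ^ 2) = sin θ := by
    rw [← sin_sq, Real.sqrt_sq (sin_nonneg_of_mem_Icc hθ)]
  have h1 : ((-1 : ℝ) ^ m) * (-1) ^ m = 1 := by rw [← mul_pow]; simp
  rw [Kfun, legendreP, hs]
  linear_combination (√((l - m).factorial / (l + m).factorial) / (2 ^ l * l.factorial) *
      (sin θ ^ m * (derivative^[l + m] ((X ^ 2 - 1 : ℝ[X]) ^ l)).eval (cos θ))) * h1

lemma integral_Kfun_mul {l m : ℕ} (l' : ℕ) (hm : m ≤ l) :
    ∫ θ in (0)..π, sin θ * (Kfun l m (cos θ) * Kfun l' m (cos θ))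
      = if l = l' then 2 / (2 * (l : ℝ) + 1) else 0 := by
  have hcongr : ∫ θ in (0)..π, sin θ * (Kfun l m (cos θ) * Kfun l' m (cos θ))
      = √((l - m).factorial / (l + m).factorial) / (2 ^ l * l.factorial) *
        (√((l' - m).factorial / (l' + m).factorial) / (2 ^ l' * l'.factorial)) *
        ∫ θ in (0)..π, sin θ ^ (2 * m + 1) *
          ((derivative^[l + m] ((X ^ 2 - 1 : ℝ[X]) ^ l)).eval (cos θ)
            * (derivative^[l' + m] ((X ^ 2 - 1 : ℝ[X]) ^ l')).eval (cos θ)) := by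
    rw [← intervalIntegral.integral_const_mul]
    refine intervalIntegral.integral_congr fun θ hθ => ?_
    rw [Set.uIcc_of_le pi_pos.le] at hθ
    simp only [Kfun_cos _ _ hθ]
    ring
  rw [hcongr]
  split_ifs with h
  · subst h
    rw [integral_sin_pow_mul_legendre_self l m hm]
    have hsq := Real.mul_self_sqrt
      (show (0 : ℝ) ≤ (l - m).factorial / (l + m).factorial by positivity)
    rw [div_mul_div_comm, hsq]
    have h1 := Nat.factorial_ne_zero (l - m)
    have h2 := Nat.factorial_ne_zero (l + m)
    have h3 := Nat.factorial_ne_zero l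
    field_simp
  · rw [integral_sin_pow_mul_legendre_of_ne h, mul_zero]

lemma integral_chebDeriv_mul {k l : ℕ} (k' : ℕ) (hl : l ≤ k) :
    ∫ χ in (0)..π, sin χ ^ (2 * (l + 1)) *
        (chebDeriv (k + 1) (l + 1) (cos χ) * chebDeriv (k' + 1) (l + 1) (cos χ))
      = if k = k' then akl k l else 0 := by
  unfold chebDeriv
  split_ifs with h
  · subst h
    rw [integral_sin_pow_mul_iterate_derivative_T_self k (l + 1) (by omega), akl,
      show k + 1 - (l + 1) = k - l by omega, ← add_assoc]
    ring
  · exact integral_sin_pow_mul_iterate_derivative_T_of_ne (by omega) (l + 1)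

lemma akl_pos (k l : ℕ) : 0 < akl k l := by
  have := pi_pos
  unfold akl
  positivity

end NormalizedFactors

section Coordinates

variable {r θ φ : ℝ}

lemma norm_sphericalPoint (hr : 0 < r) : ‖sphericalPoint ((r, θ), φ)‖ = r := by
  rw [EuclideanSpace.norm_eq, Fin.sum_univ_three]
  simp only [sphericalPoint, Real.norm_eq_abs, sq_abs]
  simp only [Matrix.cons_val_zero, Matrix.cons_val_one, Matrix.cons_val]
  rw [show (r * sin θ * cos φ) ^ 2 + (r * sin θ * sin φ) ^ 2 + (r * cos θ) ^ 2 = r ^ 2 by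
    linear_combination (r * sin θ) ^ 2 * sin_sq_add_cos_sq φ + r ^ 2 * sin_sq_add_cos_sq θ]
  exact Real.sqrt_sq hr.le

lemma sphTheta_sphericalPoint (hr : 0 < r) (hθ : θ ∈ Set.Ioo 0 π) :
    sphTheta (sphericalPoint ((r, θ), φ)) = θ := by
  rw [sphTheta, norm_sphericalPoint hr]
  simp only [sphericalPoint, PiLp.toLp_apply, Matrix.cons_val]
  rw [mul_div_cancel_left₀ _ hr.ne', arccos_cos hθ.1.le hθ.2.le]

lemma sphPhi_sphericalPoint (hr : 0 < r) (hθ : θ ∈ Set.Ioo 0 π) (hφ : φ ∈ Set.Ioo (-π) π) :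
    sphPhi (sphericalPoint ((r, θ), φ)) = φ := by
  have h := Complex.arg_mul_cos_add_sin_mul_I (mul_pos hr (sin_pos_of_mem_Ioo hθ))
    ⟨hφ.1, hφ.2.le⟩
  rw [sphPhi]
  convert h using 2
  apply Complex.ext <;>
    simp [sphericalPoint, ← Complex.ofReal_cos, ← Complex.ofReal_sin]

lemma measurable_Wfun (α : ℕ × ℕ × ℤ) : Measurable (Wfun α) := by
  have hφ : Measurable sphPhi := by
    refine Complex.measurable_arg.comp ?_
    refine Complex.measurableEquivRealProd.symm.measurable.comp
      (g := Complex.measurableEquivRealProd.symm) (f := fun x : E3 => (x 0, x 1)) ?_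
    fun_prop
  have hθ : Measurable sphTheta := by unfold sphTheta; fun_prop
  have hχ : Measurable sphChi := by unfold sphChi; fun_prop
  have hy : ∀ m, Measurable (ymfun m) := by
    intro m
    rcases lt_or_ge m 0 with hm | hm
    · rw [funext (ymfun_of_neg hm)]
      fun_prop
    · rw [funext (ymfun_of_nonneg hm)]
      fun_prop
  have hy' := (hy α.2.2).comp hφ
  simp only [Function.comp_def] at hy'
  unfold Wfun Yfun chebDeriv Y2fun Kfun legendreP
  fun_prop

end Coordinates

/-- Weighted orthogonality:
`∫_{ℝ³} 𝒲_α 𝒲_β / (|x|²+1)² dx = (1/4) δ_{αβ}` for all `α, β ∈ Λ`. -/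
theorem AB_weighted_orthogonality (α β : ℕ × ℕ × ℤ) (hα : memLam α) (hβ : memLam β) :
    (∫ x : E3, Wfun α x * Wfun β x / (‖x‖^2+1)^2)
      = (1/4) * (if α = β then (1:ℝ) else 0) := by
  obtain ⟨k, l, m⟩ := α
  obtain ⟨k', l', m'⟩ := β
  obtain ⟨hlk, hml⟩ := hα
  dsimp only at hlk hml
  obtain ⟨G, hG⟩ : ∃ G : ℝ → ℝ, ∀ χ, G χ = 1 / √(akl k l) * (1 / √(akl k' l')) *
      (sin χ ^ (l + l') * (chebDeriv (k + 1) (l + 1) (cos χ)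
        * chebDeriv (k' + 1) (l' + 1) (cos χ))) := ⟨_, fun _ => rfl⟩
  rw [integral_eq_of_separated (F := fun x => Wfun (k, l, m) x * Wfun (k', l', m') x
        / (‖x‖ ^ 2 + 1) ^ 2)
      (f := fun r => 2 / (r ^ 2 + 1) ^ 3 * G (arccos ((r ^ 2 - 1) / (r ^ 2 + 1))))
      (g := fun θ => √((2 * l + 1) / (2 * π)) * √((2 * l' + 1) / (2 * π)) *
        (Kfun l m.natAbs (cos θ) * Kfun l' m'.natAbs (cos θ)))
      (h := fun φ => ymfun m φ * ymfun m' φ),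
    integral_stereographic, integral_ymfun_mul]
  · by_cases hm : m = m'
    swap
    · simp [hm]
    subst hm
    simp only [mul_left_comm (sin _) (√_ * √_)]
    rw [intervalIntegral.integral_const_mul, integral_Kfun_mul l' hml]
    by_cases hl : l = l'
    swap
    · simp [hl]
    subst hl
    have hχ : ∀ χ : ℝ, sin χ ^ 2 * G χ
        = 1 / √(akl k l) * (1 / √(akl k' l)) * (sin χ ^ (2 * (l + 1)) *
          (chebDeriv (k + 1) (l + 1) (cos χ) * chebDeriv (k' + 1) (l + 1) (cos χ))) := by
      intro χ
      rw [hG]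
      ring
    simp only [hχ]
    rw [intervalIntegral.integral_const_mul, integral_chebDeriv_mul k' hlk]
    by_cases hk : k = k'
    swap
    · simp [hk]
    subst hk
    have ha := akl_pos k l
    have hπ := pi_pos
    have h1 := Real.mul_self_sqrt ha.le
    have h2 := Real.mul_self_sqrt (show (0 : ℝ) ≤ (2 * l + 1) / (2 * π) by positivity)
    rw [h2]
    have h3 : 1 / √(akl k l) * (1 / √(akl k l)) * akl k l = 1 := by
      rw [one_div_mul_one_div, h1, one_div_mul_cancel ha.ne']
    simp only [if_true, h3]
    field_simp
  · exact ((measurable_Wfun _).mul (measurable_Wfun _)).div (by fun_prop)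
  · intro r θ φ hr hθ hφ
    have hs := Real.mul_self_sqrt (show (0 : ℝ) ≤ 2 / (r ^ 2 + 1) by positivity)
    simp only [Wfun, Yfun, Y2fun, sphChi, norm_sphericalPoint hr, sphTheta_sphericalPoint hr hθ,
      sphPhi_sphericalPoint hr hθ hφ]
    have h3 : 2 / (r ^ 2 + 1) ^ 3 = √(2 / (r ^ 2 + 1)) * √(2 / (r ^ 2 + 1)) / (r ^ 2 + 1) ^ 2 := by
      rw [hs]
      field_simp
    rw [h3, hG]
    ring

end
end
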